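/- arXiv:2508.08323 — 3 statements merged into one kernel-verified Lean document; each statement's English description precedes it below -/
import Mathlib

section
/- For every natural number k ≥ 2, the polynomial x^(2k-1) - x^k - x^(k-1) - 1 is irreducible in ℚ[x]. -/
open Polynomial

/-- Four-term integer polynomials `u + s X ^ a + t X ^ b + w X ^ n` with nonzero constant and
leading coefficients have degree `n`. -/
theorem natDegree_quadrinomial {a b n : ℕ} (ha : 0 < a) (hab : a < b) (hbn : b < n)
    (u s t : ℤ) {w : ℤ} (hw : w ≠ 0) :
    (C u + C s * X ^ a + C t * X ^ b + C w * X ^ n).natDegree = n := by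
  apply natDegree_eq_of_le_of_coeff_ne_zero
  · compute_degree
    omega
  · have h1 : n ≠ a := by omega
    have h2 : n ≠ b := by omega
    have h3 : n ≠ 0 := by omega
    simp [-eq_intCast, coeff_X_pow, coeff_C, h1, h2, h3, hw]

theorem natTrailingDegree_quadrinomial {a b n : ℕ} (ha : 0 < a) (hab : a < b) (hbn : b < n)
    {u : ℤ} (hu : u ≠ 0) (s t w : ℤ) :
    (C u + C s * X ^ a + C t * X ^ b + C w * X ^ n).natTrailingDegree = 0 := by
  rw [natTrailingDegree_eq_zero]
  right
  simp [coeff_X_pow, ha.ne, (ha.trans hab).ne, ((ha.trans hab).trans hbn).ne, hu]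

theorem mirror_quadrinomial {a b n : ℕ} (ha : 0 < a) (hab : a < b) (hbn : b < n)
    {u w : ℤ} (hu : u ≠ 0) (s t : ℤ) (hw : w ≠ 0) :
    (C u + C s * X ^ a + C t * X ^ b + C w * X ^ n).mirror =
      C u * X ^ n + C s * X ^ (n - a) + C t * X ^ (n - b) + C w := by
  rw [mirror, natTrailingDegree_quadrinomial ha hab hbn hu, pow_zero, mul_one, reverse,
    natDegree_quadrinomial ha hab hbn u s t hw]
  simp only [reflect_add, reflect_C_mul_X_pow, reflect_C]
  rw [revAt_le (hab.trans hbn).le, revAt_le hbn.le, revAt_le le_rfl]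
  simp

/-- An integer polynomial whose squared coefficients sum to `4`, and whose constant and leading
coefficients are units, is a quadrinomial with unit coefficients. -/
theorem eq_quadrinomial_of_sum_sq_eq_four {q : ℤ[X]} (hdeg : 0 < q.natDegree)
    (h0 : q.coeff 0 ^ 2 = 1) (hlead : q.coeff q.natDegree ^ 2 = 1)
    (hsum : (q.sum fun _ c => c ^ 2) = 4) :
    ∃ a b : ℕ, ∃ s t : ℤ, 0 < a ∧ a < b ∧ b < q.natDegree ∧ s ^ 2 = 1 ∧ t ^ 2 = 1 ∧
      q = C (q.coeff 0) + C s * X ^ a + C t * X ^ b +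
        C (q.coeff q.natDegree) * X ^ q.natDegree := by
  set n := q.natDegree with hn
  have mem0 : 0 ∈ q.support := by
    rw [mem_support_iff]
    intro h
    simp [h] at h0
  have memn : n ∈ q.support.erase 0 := by
    rw [Finset.mem_erase, mem_support_iff]
    refine ⟨hdeg.ne', fun h => ?_⟩
    simp [h] at hlead
  set T := (q.support.erase 0).erase n with hT
  have hsumT : ∑ i ∈ T, q.coeff i ^ 2 = 2 := by
    rw [sum_def, ← Finset.add_sum_erase _ _ mem0, ← Finset.add_sum_erase _ _ memn, h0,
      hlead] at hsum
    linarith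
  have hone : ∀ i ∈ T, q.coeff i ^ 2 = 1 := by
    intro i hi
    have hne : q.coeff i ≠ 0 :=
      mem_support_iff.mp (Finset.mem_of_mem_erase (Finset.mem_of_mem_erase hi))
    have hle : q.coeff i ^ 2 ≤ 2 :=
      hsumT ▸ Finset.single_le_sum (f := fun i => q.coeff i ^ 2) (fun j _ => sq_nonneg _) hi
    exact Int.sq_eq_one_of_sq_le_three (by linarith) hne
  have hcard : T.card = 2 := by
    rw [Finset.sum_congr rfl hone, Finset.sum_const, Nat.smul_one_eq_cast] at hsumT
    exact_mod_cast hsumT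
  have hmem : ∀ i ∈ T, 0 < i ∧ i < n := by
    intro i hi
    have h1 := Finset.ne_of_mem_erase hi
    have h2 := Finset.ne_of_mem_erase (Finset.mem_of_mem_erase hi)
    have h3 := le_natDegree_of_mem_supp i
      (Finset.mem_of_mem_erase (Finset.mem_of_mem_erase hi))
    omega
  obtain ⟨a, b, hab, hTab⟩ : ∃ a b, a < b ∧ T = {a, b} := by
    obtain ⟨a, b, hne, hTab⟩ := Finset.card_eq_two.mp hcard
    rcases hne.lt_or_gt with h | h
    · exact ⟨a, b, h, hTab⟩
    · exact ⟨b, a, h, hTab.trans (Finset.pair_comm a b)⟩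
  have haT : a ∈ T := by simp [hTab]
  have hbT : b ∈ T := by simp [hTab]
  refine ⟨a, b, q.coeff a, q.coeff b, (hmem a haT).1, hab, (hmem b hbT).2, hone a haT,
    hone b hbT, ?_⟩
  conv_lhs => rw [q.as_sum_support_C_mul_X_pow, ← Finset.add_sum_erase _ _ mem0,
    ← Finset.add_sum_erase _ _ memn, ← hT, hTab, Finset.sum_pair hab.ne]
  rw [pow_zero, mul_one]
  ring

/-- The identity in the hypothesis expresses, for `q = X ^ a + X ^ b - e (X ^ n - 1)` with
`n = 2 j + 1`, that `q * q.mirror` has the value it takes at `a = j` and `b = j + 1`. -/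
theorem exponents_of_mul_mirror_eq {a b j : ℕ} (ha : 0 < a) (hab : a < b) (hb : b < 2 * j + 1)
    {e : ℤ} (he : e = 1 ∨ e = -1)
    (h : C e * (X ^ (2 * j + 1) - 1) * (X ^ a + X ^ b - X ^ (2 * j + 1 - a) - X ^ (2 * j + 1 - b))
        + X ^ (2 * j + 1 + b - a) + X ^ (2 * j + 1 + a - b) =
      (X ^ (2 * j + 2) + X ^ (2 * j) : ℤ[X])) :
    a = j ∧ b = j + 1 := by
  have hc : ∀ m < 2 * j + 1,
      (if m = 2 * j + 1 + a - b then 1 else 0) -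
        e * ((if m = a then 1 else 0) + (if m = b then 1 else 0) -
          (if m = 2 * j + 1 - a then 1 else 0) - (if m = 2 * j + 1 - b then 1 else 0)) =
      (if m = 2 * j then (1 : ℤ) else 0) := by
    intro m hm
    have := congrArg (coeff · m) h
    simp only [mul_assoc, sub_mul, one_mul, coeff_add, coeff_C_mul, coeff_sub, coeff_X_pow_mul',
      coeff_X_pow] at this
    rw [if_neg (by omega), if_neg (show m ≠ 2 * j + 1 + b - a by omega),
      if_neg (show m ≠ 2 * j + 2 by omega)] at this
    linarith
  by_cases hs : a + b = 2 * j + 1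
  · have := hc (2 * j) (by omega)
    rcases he with rfl | rfl <;> grind
  · exfalso
    have h1 := hc a (by omega)
    have h2 := hc b (by omega)
    have h3 := hc (2 * j + 1 - a) (by omega)
    have h4 := hc (2 * j + 1 - b) (by omega)
    rcases he with rfl | rfl <;> grind

theorem mirror_liechti_strenner {j : ℕ} (hj : 0 < j) :
    (X ^ (2 * j + 1) - X ^ (j + 1) - X ^ j - 1 : ℤ[X]).mirror =
      1 - X ^ (j + 1) - X ^ j - X ^ (2 * j + 1) := by
  have h := mirror_quadrinomial (n := 2 * j + 1) hj (Nat.lt_succ_self j) (by omega)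
    (u := -1) (w := 1) (by norm_num) (-1) (-1) (by norm_num)
  rw [show 2 * j + 1 - j = j + 1 by omega, show 2 * j + 1 - j.succ = j by omega] at h
  simp only [map_neg, map_one, Nat.succ_eq_add_one] at h
  convert h using 1
  · congr 1
    ring
  · ring

theorem natDegree_liechti_strenner {j : ℕ} (hj : 0 < j) :
    (X ^ (2 * j + 1) - X ^ (j + 1) - X ^ j - 1 : ℤ[X]).natDegree = 2 * j + 1 := by
  have h := natDegree_quadrinomial (n := 2 * j + 1) hj (Nat.lt_succ_self j) (by omega)
    (-1) (-1) (-1) (w := 1) (by norm_num)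
  simp only [map_neg, map_one, Nat.succ_eq_add_one] at h
  convert h using 2
  ring

theorem monic_liechti_strenner {j : ℕ} (hj : 0 < j) :
    (X ^ (2 * j + 1) - X ^ (j + 1) - X ^ j - 1 : ℤ[X]).Monic := by
  rw [Monic, leadingCoeff, natDegree_liechti_strenner hj]
  simp [coeff_X_pow, coeff_one, show 2 * j ≠ j by omega, show 2 * j + 1 ≠ j by omega]

theorem natTrailingDegree_liechti_strenner {j : ℕ} (hj : 0 < j) :
    (X ^ (2 * j + 1) - X ^ (j + 1) - X ^ j - 1 : ℤ[X]).natTrailingDegree = 0 := by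
  rw [natTrailingDegree_eq_zero]
  right
  simp [coeff_X_pow, hj.ne]

theorem isRelPrime_mirror_liechti_strenner {j : ℕ} (hj : 0 < j) :
    IsRelPrime (X ^ (2 * j + 1) - X ^ (j + 1) - X ^ j - 1 : ℤ[X])
      (X ^ (2 * j + 1) - X ^ (j + 1) - X ^ j - 1 : ℤ[X]).mirror := by
  intro d hd hd'
  have hprim := (monic_liechti_strenner hj).isPrimitive
  rw [mirror_liechti_strenner hj] at hd'
  have hcop : IsCoprime d (X ^ j) := by
    refine IsCoprime.of_isCoprime_of_dvd_left ?_ hd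
    exact ⟨-1, X ^ (j + 1) - X - 1, by ring⟩
  have hdvd : d ∣ X ^ j * (2 * (X + 1)) := by
    have := (dvd_add hd hd').neg_right
    convert this using 1
    ring
  replace hdvd := hcop.dvd_of_dvd_mul_left hdvd
  obtain ⟨r, hr⟩ : (X + 1 : ℤ[X]) ∣ X ^ (2 * j + 1) - X ^ (j + 1) - X ^ j - 1 + 2 := by
    have h : (X - C (-1) : ℤ[X]) ∣ X ^ (2 * j + 1) - X ^ (j + 1) - X ^ j - 1 + 2 := by
      rw [dvd_iff_isRoot, IsRoot]
      simp [pow_succ, pow_mul]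
    simpa using h
  have hfour : d ∣ C 4 := by
    have := dvd_sub (hdvd.mul_right r) (hd.mul_left 2)
    convert this using 1
    rw [show (C 4 : ℤ[X]) = 4 from rfl]
    linear_combination (2 : ℤ[X]) * hr
  have hdeg : d.natDegree = 0 := by
    have := natDegree_le_of_dvd hfour (by simp)
    simpa using this
  rw [eq_C_of_natDegree_eq_zero hdeg] at hd ⊢
  exact isUnit_C.mpr (hprim _ hd)

theorem eq_of_mul_mirror_eq_liechti_strenner {j : ℕ} (hj : 0 < j) {q : ℤ[X]}
    (h : (X ^ (2 * j + 1) - X ^ (j + 1) - X ^ j - 1 : ℤ[X]) *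
      (X ^ (2 * j + 1) - X ^ (j + 1) - X ^ j - 1 : ℤ[X]).mirror = q * q.mirror) :
    q = X ^ (2 * j + 1) - X ^ (j + 1) - X ^ j - 1 ∨
      q = -(X ^ (2 * j + 1) - X ^ (j + 1) - X ^ j - 1) ∨
      q = (X ^ (2 * j + 1) - X ^ (j + 1) - X ^ j - 1 : ℤ[X]).mirror ∨
      q = -(X ^ (2 * j + 1) - X ^ (j + 1) - X ^ j - 1 : ℤ[X]).mirror := by
  have hdeg : q.natDegree = 2 * j + 1 := by
    have := congrArg natDegree h
    rw [natDegree_mul_mirror, natDegree_mul_mirror, natDegree_liechti_strenner hj] at this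
    omega
  have htrail : q.natTrailingDegree = 0 := by
    have := congrArg natTrailingDegree h
    rw [natTrailingDegree_mul_mirror, natTrailingDegree_mul_mirror,
      natTrailingDegree_liechti_strenner hj] at this
    omega
  have hprod : q.coeff (2 * j + 1) * q.coeff 0 = -1 := by
    have := congrArg leadingCoeff h
    rw [leadingCoeff_mul, leadingCoeff_mul, mirror_leadingCoeff, mirror_leadingCoeff,
      monic_liechti_strenner hj, trailingCoeff, trailingCoeff, htrail,
      natTrailingDegree_liechti_strenner hj, leadingCoeff, hdeg] at this
    rw [← this]
    simp [hj.ne]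
  have hsum : (q.sum fun _ c => c ^ 2) = 4 := by
    rw [← coeff_mul_mirror, ← h, hdeg, htrail, mirror_liechti_strenner hj,
      show (X ^ (2 * j + 1) - X ^ (j + 1) - X ^ j - 1 : ℤ[X]) *
        (1 - X ^ (j + 1) - X ^ j - X ^ (2 * j + 1)) =
        -X ^ (4 * j + 2) + X ^ (2 * j + 2) + C 4 * X ^ (2 * j + 1) + X ^ (2 * j) - 1 by
          rw [show (C 4 : ℤ[X]) = 4 from rfl]
          ring]
    simp only [coeff_sub, coeff_add, coeff_neg, coeff_C_mul, coeff_X_pow, coeff_one]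
    grind
  have heval : q.eval 1 ^ 2 = 4 := by
    have := congrArg (eval 1) h
    rw [eval_mul, eval_mul, mirror_eval_one, mirror_eval_one] at this
    rw [sq, ← this]
    simp
  obtain ⟨hw, hu⟩ : q.coeff (2 * j + 1) ^ 2 = 1 ∧ q.coeff 0 = -q.coeff (2 * j + 1) := by
    rcases Int.mul_eq_neg_one_iff_eq_one_or_neg_one.mp hprod with ⟨h1, h2⟩ | ⟨h1, h2⟩ <;>
      simp [h1, h2]
  obtain ⟨a, b, s, t, ha, hab, hb, hs, ht, hq⟩ := eq_quadrinomial_of_sum_sq_eq_four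
    (q := q) (by omega) (by rw [hu, neg_sq, hw]) (by rw [hdeg, hw]) hsum
  rw [hdeg] at hb hq
  rw [hu] at hq
  generalize q.coeff (2 * j + 1) = w at hq hw
  have hst : t = s := by
    rw [hq] at heval
    simp only [eval_add, eval_mul, eval_C, eval_pow, eval_X, one_pow, mul_one] at heval
    rcases sq_eq_one_iff.mp hs with rfl | rfl <;>
      rcases sq_eq_one_iff.mp ht with rfl | rfl <;> first | rfl | (ring_nf at heval; omega)
  subst hst
  have hw0 : w ≠ 0 := by
    rintro rfl
    simp at hw
  have hmir := mirror_quadrinomial ha hab hb (neg_ne_zero.mpr hw0) t t hw0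
  rw [← hq] at hmir
  rw [hmir, mirror_liechti_strenner hj, hq] at h
  have hexp : a = j ∧ b = j + 1 := by
    refine exponents_of_mul_mirror_eq ha hab hb (e := -(w * t)) ?_ ?_
    · rcases sq_eq_one_iff.mp hw with rfl | rfl <;>
        rcases sq_eq_one_iff.mp ht with rfl | rfl <;> simp
    · have h1 : (X ^ a * X ^ (2 * j + 1 - a) : ℤ[X]) = X ^ (2 * j + 1) := by
        rw [← pow_add, Nat.add_sub_cancel' (by omega)]
      have h2 : (X ^ b * X ^ (2 * j + 1 - b) : ℤ[X]) = X ^ (2 * j + 1) := by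
        rw [← pow_add, Nat.add_sub_cancel' hb.le]
      have h3 : (X ^ b * X ^ (2 * j + 1 - a) : ℤ[X]) = X ^ (2 * j + 1 + b - a) := by
        rw [← pow_add]
        congr 1
        omega
      have h4 : (X ^ a * X ^ (2 * j + 1 - b) : ℤ[X]) = X ^ (2 * j + 1 + a - b) := by
        rw [← pow_add]
        congr 1
        omega
      have hw' : (C w ^ 2 : ℤ[X]) = 1 := by rw [← C_pow, hw, C_1]
      have ht' : (C t ^ 2 : ℤ[X]) = 1 := by rw [← C_pow, ht, C_1]
      rw [← h3, ← h4, C_neg, C_mul]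
      simp only [C_neg] at h
      linear_combination -h + (X ^ (2 * j + 1) - 1) ^ 2 * hw' -
        (X ^ a + X ^ b) * (X ^ (2 * j + 1 - a) + X ^ (2 * j + 1 - b)) * ht' - h1 - h2
  obtain ⟨rfl, rfl⟩ := hexp
  rw [mirror_liechti_strenner hj, hq]
  rcases sq_eq_one_iff.mp hw with rfl | rfl <;>
    rcases sq_eq_one_iff.mp ht with rfl | rfl <;> simp only [C_neg, C_1, neg_neg]
  · right; right; right; ring
  · left; ring
  · right; left; ring
  · right; right; left; ring

/-- For every natural number `k ≥ 2`, the Liechti–Strenner polynomial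
`x^(2k-1) - x^k - x^(k-1) - 1` is irreducible in `ℚ[X]`. -/
theorem liechti_strenner_irreducible_rat (k : ℕ) (hk : 2 ≤ k) :
    Irreducible (X ^ (2 * k - 1) - X ^ k - X ^ (k - 1) - 1 : ℚ[X]) := by
  obtain ⟨j, rfl⟩ : ∃ j, k = j + 1 := ⟨k - 1, by omega⟩
  have hj : 0 < j := by omega
  have hirr : Irreducible (X ^ (2 * j + 1) - X ^ (j + 1) - X ^ j - 1 : ℤ[X]) := by
    refine irreducible_of_mirror (fun hu => ?_)
      (fun q => eq_of_mul_mirror_eq_liechti_strenner hj)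
      (isRelPrime_mirror_liechti_strenner hj)
    have := natDegree_eq_zero_of_isUnit hu
    rw [natDegree_liechti_strenner hj] at this
    omega
  rw [IsPrimitive.Int.irreducible_iff_irreducible_map_cast
    (monic_liechti_strenner hj).isPrimitive] at hirr
  rw [show 2 * (j + 1) - 1 = 2 * j + 1 by omega, Nat.add_sub_cancel]
  simpa using hirr
end

section
/- For every natural number k ≥ 2, the polynomial x^(2k-1) - x^k - x^(k-1) - 1 is irreducible in ℤ[x]. -/
open Polynomial

/-- The quadrinomial `X^(b+d+c) + e X^(b+d) + e X^b - 1`. -/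
noncomputable def antiQuadrinomial (e : ℤ) (b d c : ℕ) : ℤ[X] :=
  X ^ (b + d + c) + C e * X ^ (b + d) + C e * X ^ b - 1

section

variable {e : ℤ} {b d c : ℕ}

theorem antiQuadrinomial_coeff (i : ℕ) : (antiQuadrinomial e b d c).coeff i =
    (if i = b + d + c then 1 else 0) + e * (if i = b + d then 1 else 0)
      + e * (if i = b then 1 else 0) - (if i = 0 then 1 else 0) := by
  simp only [antiQuadrinomial, coeff_sub, coeff_add, coeff_C_mul, coeff_X_pow, coeff_one]

theorem antiQuadrinomial_natDegree (hd : 0 < d) (hc : 0 < c) :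
    (antiQuadrinomial e b d c).natDegree = b + d + c := by
  apply natDegree_eq_of_le_of_coeff_ne_zero
  · rw [natDegree_le_iff_coeff_eq_zero]
    intro i hi
    rw [antiQuadrinomial_coeff, if_neg (by lia), if_neg (by lia), if_neg (by lia),
      if_neg (by lia)]
    ring
  · rw [antiQuadrinomial_coeff, if_pos rfl, if_neg (by lia), if_neg (by lia), if_neg (by lia)]
    simp

theorem antiQuadrinomial_natTrailingDegree (hb : 0 < b) :
    (antiQuadrinomial e b d c).natTrailingDegree = 0 := by
  apply natTrailingDegree_eq_zero_of_constantCoeff_ne_zero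
  rw [constantCoeff_apply, antiQuadrinomial_coeff, if_neg (by lia), if_neg (by lia),
    if_neg (by lia)]
  simp

theorem antiQuadrinomial_mirror (hb : 0 < b) (hd : 0 < d) (hc : 0 < c) :
    (antiQuadrinomial e b d c).mirror = -antiQuadrinomial (-e) c d b := by
  ext i
  rw [coeff_mirror, antiQuadrinomial_natDegree hd hc, antiQuadrinomial_natTrailingDegree hb,
    coeff_neg, antiQuadrinomial_coeff, antiQuadrinomial_coeff, add_zero]
  rcases le_or_gt i (b + d + c) with hi | hi
  · rw [revAt_le hi]
    grind
  · rw [revAt_eq_self_of_lt hi]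
    grind

theorem antiQuadrinomial_eval_one : (antiQuadrinomial e b d c).eval 1 = 2 * e := by
  simp [antiQuadrinomial]; ring

theorem antiQuadrinomial_neg_one_mul_mirror {m : ℕ} (hm : 0 < m) :
    antiQuadrinomial (-1) m 1 m * (antiQuadrinomial (-1) m 1 m).mirror =
      -X ^ (2 * (m + 1 + m)) + X ^ (m + 1 + m + 1) + 4 * X ^ (m + 1 + m) + X ^ (2 * m) - 1 := by
  rw [antiQuadrinomial_mirror hm one_pos hm]
  simp only [antiQuadrinomial, map_neg, map_one]
  ring

theorem antiQuadrinomial_exponents_relation (he : e ^ 2 = 1) {m : ℕ} (hm : 0 < m) (hb : 0 < b)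
    (hd : 0 < d) (hc : 0 < c) (hn : b + d + c = m + 1 + m)
    (h : antiQuadrinomial e b d c * (antiQuadrinomial e b d c).mirror =
      antiQuadrinomial (-1) m 1 m * (antiQuadrinomial (-1) m 1 m).mirror) {j : ℕ} (_hj : 0 < j) :
    e * ((if j = c then 1 else 0) + (if j = c + d then 1 else 0) - (if j = b + d then 1 else 0)
      - (if j = b then 1 else 0)) + (if j = d then 1 else 0) = (if j = 1 then 1 else 0) := by
  rw [antiQuadrinomial_neg_one_mul_mirror hm, antiQuadrinomial_mirror hb hd hc, ← hn] at h
  have hE : (C e : ℤ[X]) ^ 2 = 1 := by rw [← C_pow, he, C_1]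
  have key : X ^ (b + d + c) *
      (C e * (X ^ c + X ^ (c + d) - X ^ (b + d) - X ^ b) + X ^ d - X ^ 1 : ℤ[X]) =
      C e * (X ^ c + X ^ (c + d) - X ^ (b + d) - X ^ b) - X ^ (b + c) + X ^ (2 * m) := by
    simp only [antiQuadrinomial, map_neg] at h
    linear_combination h - (X ^ (b + d + c) * X ^ d + 2 * X ^ (b + d + c) + X ^ (b + c)) * hE
  have := congrArg (fun p => coeff p (b + d + c + j)) key
  simp only [add_comm (b + d + c) j, coeff_X_pow_mul, coeff_sub, coeff_add, coeff_C_mul,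
    coeff_X_pow] at this
  rw [if_neg (show ¬ j + (b + d + c) = c by lia), if_neg (show ¬ j + (b + d + c) = c + d by lia),
    if_neg (show ¬ j + (b + d + c) = b + d by lia), if_neg (show ¬ j + (b + d + c) = b by lia),
    if_neg (show ¬ j + (b + d + c) = b + c by lia),
    if_neg (show ¬ j + (b + d + c) = 2 * m by lia)] at this
  linarith

theorem exponents_eq (he : e = 1 ∨ e = -1) (hb : 0 < b) (hd : 0 < d) (hc : 0 < c)
    (h : ∀ j : ℕ, 0 < j →
      e * ((if j = c then 1 else 0) + (if j = c + d then 1 else 0) - (if j = b + d then 1 else 0)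
        - (if j = b then 1 else 0)) + (if j = d then 1 else 0) = (if j = 1 then 1 else 0)) :
    d = 1 ∧ b = c := by
  have h1 := h 1 one_pos
  have h2 := h c hc
  have h3 := h d hd
  have h4 := h b hb
  have h5 := h (c + d) (by lia)
  have h6 := h (b + d) (by lia)
  rcases he with rfl | rfl <;> grind

end

theorem exists_pair_of_sum_sq_eq_two {s : Finset ℕ} {f : ℕ → ℤ} (h : ∑ i ∈ s, f i ^ 2 = 2) :
    ∃ b ∈ s, ∃ a ∈ s, b < a ∧ f b ^ 2 = 1 ∧ f a ^ 2 = 1 ∧ ∀ i ∈ s, i ≠ a → i ≠ b → f i = 0 := by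
  have sq_eq_one : ∀ x : ℤ, x ≠ 0 → x ^ 2 ≤ 2 → x ^ 2 = 1 := by
    intro x hx h2
    have : x ≤ 1 := by nlinarith
    have : -1 ≤ x := by nlinarith
    have : x = 1 ∨ x = -1 := by lia
    rcases this with rfl | rfl <;> norm_num
  obtain ⟨a, ha, hfa⟩ : ∃ a ∈ s, f a ^ 2 ≠ 0 := Finset.exists_ne_zero_of_sum_ne_zero (by lia)
  have hsa := Finset.add_sum_erase s (fun i => f i ^ 2) ha
  have hna : 0 ≤ ∑ i ∈ s.erase a, f i ^ 2 := Finset.sum_nonneg fun i _ => sq_nonneg _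
  have ha1 := sq_eq_one (f a) (by simpa using hfa) (by lia)
  obtain ⟨b, hb, hfb⟩ : ∃ b ∈ s.erase a, f b ^ 2 ≠ 0 :=
    Finset.exists_ne_zero_of_sum_ne_zero (by lia)
  have hsb := Finset.add_sum_erase (s.erase a) (fun i => f i ^ 2) hb
  have hnb : 0 ≤ ∑ i ∈ (s.erase a).erase b, f i ^ 2 := Finset.sum_nonneg fun i _ => sq_nonneg _
  have hb1 := sq_eq_one (f b) (by simpa using hfb) (by lia)
  have h0 : ∑ i ∈ (s.erase a).erase b, f i ^ 2 = 0 := by lia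
  rw [Finset.sum_eq_zero_iff_of_nonneg fun i _ => sq_nonneg _] at h0
  have hz : ∀ i ∈ s, i ≠ a → i ≠ b → f i = 0 := fun i hi hia hib => by
    simpa using h0 i (by simp [hi, hia, hib])
  rw [Finset.mem_erase] at hb
  rcases lt_or_gt_of_ne hb.1 with hlt | hlt
  · exact ⟨b, hb.2, a, ha, hlt, hb1, ha1, hz⟩
  · exact ⟨a, ha, b, hb.2, hlt, ha1, hb1, fun i hi h1 h2 => hz i hi h2 h1⟩

theorem eq_of_mul_mirror_eq_of_leadingCoeff {m : ℕ} (hm : 0 < m) {p : ℤ[X]}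
    (h : antiQuadrinomial (-1) m 1 m * (antiQuadrinomial (-1) m 1 m).mirror = p * p.mirror)
    (hp : p.leadingCoeff = 1) :
    p = antiQuadrinomial (-1) m 1 m ∨ p = -(antiQuadrinomial (-1) m 1 m).mirror := by
  have hdeg : p.natDegree = m + 1 + m := by
    have := congrArg natDegree h
    rw [natDegree_mul_mirror, natDegree_mul_mirror, antiQuadrinomial_natDegree one_pos hm] at this
    lia
  have htr : p.natTrailingDegree = 0 := by
    have := congrArg natTrailingDegree h
    rw [natTrailingDegree_mul_mirror, natTrailingDegree_mul_mirror,
      antiQuadrinomial_natTrailingDegree hm] at this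
    lia
  have hlead : p.coeff (m + 1 + m) = 1 := by rw [← hdeg]; exact hp
  have hexp := antiQuadrinomial_neg_one_mul_mirror hm
  have hzero : p.coeff 0 = -1 := by
    have h0 := congrArg (fun q => coeff q 0) (h.symm.trans hexp)
    have h1 : p.mirror.coeff 0 = 1 := by
      rw [coeff_mirror, hdeg, htr, add_zero, revAt_zero, hlead]
    simp only [mul_coeff_zero, h1, coeff_sub, coeff_add, coeff_neg, coeff_ofNat_mul, coeff_X_pow,
      coeff_one_zero] at h0
    rw [if_neg (by lia), if_neg (by lia), if_neg (by lia), if_neg (by lia)] at h0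
    linarith
  have hsum : ∑ i ∈ Finset.Ioo 0 (m + 1 + m), p.coeff i ^ 2 = 2 := by
    have h4 : (p * p.mirror).coeff (m + 1 + m) = 4 := by
      rw [← h, hexp]
      simp only [coeff_sub, coeff_add, coeff_neg, coeff_ofNat_mul, coeff_X_pow, coeff_one]
      rw [if_neg (by lia), if_neg (by lia), if_pos trivial, if_neg (by lia), if_neg (by lia)]
      norm_num
    have h5 := coeff_mul_mirror p
    rw [hdeg, htr, add_zero, h4, sum_over_range _ (by simp), hdeg, Finset.sum_range_succ,
      Finset.range_eq_Ico, ← Finset.add_sum_Ioo_eq_sum_Ico (by lia), hlead, hzero] at h5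
    linarith
  obtain ⟨b, hb, a, ha, hba, hb1, ha1, hz⟩ := exists_pair_of_sum_sq_eq_two hsum
  rw [Finset.mem_Ioo] at ha hb
  obtain ⟨d, rfl⟩ := Nat.exists_eq_add_of_lt hba
  obtain ⟨c, hc⟩ := Nat.exists_eq_add_of_lt ha.2
  have hpq : p = X ^ (m + 1 + m) + C (p.coeff (b + d + 1)) * X ^ (b + d + 1)
      + C (p.coeff b) * X ^ b - 1 := by
    ext i
    simp only [coeff_sub, coeff_add, coeff_C_mul, coeff_X_pow, coeff_one]
    have hbig : m + 1 + m < i → p.coeff i = 0 := fun hi =>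
      coeff_eq_zero_of_natDegree_lt (by lia)
    have := hz i
    rw [Finset.mem_Ioo] at this
    grind
  have hone : (p.coeff (b + d + 1) + p.coeff b) ^ 2 = 4 := by
    have h1 := congrArg (eval 1) h
    rw [eval_mul, eval_mul, mirror_eval_one, mirror_eval_one, antiQuadrinomial_eval_one] at h1
    have h2 := congrArg (eval 1) hpq
    simp only [eval_sub, eval_add, eval_mul, eval_C, eval_pow, eval_X, eval_one, one_pow] at h2
    rw [h2] at h1
    linarith
  have heq : p.coeff (b + d + 1) = p.coeff b := by nlinarith
  rw [heq, hc, add_assoc b d 1, add_assoc (b + (d + 1)) c 1] at hpq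
  change p = antiQuadrinomial (p.coeff b) b (d + 1) (c + 1) at hpq
  have he : p.coeff b = 1 ∨ p.coeff b = -1 := by
    rwa [← mul_self_eq_one_iff, ← sq]
  generalize p.coeff b = e at *
  subst hpq
  obtain ⟨hd1, rfl⟩ := exponents_eq he hb.1 d.succ_pos c.succ_pos fun j hj =>
    antiQuadrinomial_exponents_relation hb1 hm hb.1 d.succ_pos c.succ_pos (by lia) h.symm hj
  obtain rfl : m = c + 1 := by lia
  obtain rfl : d = 0 := by lia
  rw [antiQuadrinomial_mirror hm one_pos hm]
  rcases he with rfl | rfl <;> simp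

theorem isRelPrime_antiQuadrinomial_mirror {m : ℕ} (hm : 0 < m) :
    IsRelPrime (antiQuadrinomial (-1) m 1 m) (antiQuadrinomial (-1) m 1 m).mirror := by
  intro q hq hq'
  have hlead : IsUnit q.leadingCoeff := by
    obtain ⟨r, hr⟩ := hq
    have h1 : (antiQuadrinomial (-1) m 1 m).leadingCoeff = 1 := by
      rw [leadingCoeff, antiQuadrinomial_natDegree one_pos hm, antiQuadrinomial_coeff,
        if_pos rfl, if_neg (by lia), if_neg (by lia), if_neg (by lia)]
      norm_num
    rw [hr, leadingCoeff_mul] at h1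
    exact IsUnit.of_mul_eq_one _ h1
  by_cases hdeg : q.natDegree = 0
  · rw [eq_C_of_natDegree_eq_zero hdeg, isUnit_C]
    rwa [leadingCoeff, hdeg] at hlead
  exfalso
  obtain ⟨z, hz⟩ : ∃ z : ℂ, aeval z q = 0 := by
    have hinj : Function.Injective (algebraMap ℤ ℂ) := (algebraMap ℤ ℂ).injective_int
    obtain ⟨z, hz⟩ := IsAlgClosed.exists_eval₂_eq_zero_of_injective (algebraMap ℤ ℂ) hinj q
      (fun h0 => hdeg (natDegree_eq_of_degree_eq_some h0))
    exact ⟨z, hz⟩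
  have h1 := aeval_eq_zero_of_dvd_aeval_eq_zero hq hz
  have h2 := aeval_eq_zero_of_dvd_aeval_eq_zero hq' hz
  rw [antiQuadrinomial_mirror hm one_pos hm] at h2
  simp only [antiQuadrinomial, map_sub, map_add, map_mul, map_neg, map_one, map_pow,
    aeval_X] at h1 h2
  have h3 : z ^ (m + 1 + m) = 1 := by linear_combination (h1 - h2) / 2
  have h4 : z ^ m * (z + 1) = 0 := by linear_combination -(h1 + h2) / 2
  rcases mul_eq_zero.mp h4 with h5 | h5
  · rw [pow_add, h5, mul_zero] at h3
    exact zero_ne_one h3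
  · rw [eq_neg_of_add_eq_zero_left h5, Odd.neg_one_pow ⟨m, by ring⟩] at h3
    norm_num at h3

theorem irreducible_antiQuadrinomial {m : ℕ} (hm : 0 < m) :
    Irreducible (antiQuadrinomial (-1) m 1 m) := by
  refine irreducible_of_mirror (fun hu => ?_) (fun p h => ?_)
    (isRelPrime_antiQuadrinomial_mirror hm)
  · have := natDegree_eq_zero_of_isUnit hu
    rw [antiQuadrinomial_natDegree one_pos hm] at this
    lia
  · have hl : p.leadingCoeff = 1 ∨ p.leadingCoeff = -1 := by
      have h1 := congrArg leadingCoeff h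
      rw [leadingCoeff_mul, leadingCoeff_mul, antiQuadrinomial_mirror hm one_pos hm,
        leadingCoeff_neg, leadingCoeff, leadingCoeff, antiQuadrinomial_natDegree one_pos hm,
        antiQuadrinomial_natDegree one_pos hm, antiQuadrinomial_coeff, antiQuadrinomial_coeff,
        if_pos rfl, if_neg (by lia), if_neg (by lia), if_neg (by lia)] at h1
      exact Int.isUnit_iff.mp (isUnit_of_dvd_unit ⟨_, h1⟩ (by norm_num))
    rcases hl with hl | hl
    · rcases eq_of_mul_mirror_eq_of_leadingCoeff hm h hl with h1 | h1 <;> simp [h1]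
    · have hm' : (-p).mirror = -p.mirror := mirror_neg p
      rcases eq_of_mul_mirror_eq_of_leadingCoeff hm (p := -p)
        (by rw [hm', neg_mul_neg, h]) (by rw [leadingCoeff_neg, hl, neg_neg]) with h1 | h1
      · simp [← h1]
      · exact Or.inr (Or.inr (Or.inl (neg_injective h1)))

/-- For every natural number `k ≥ 2`, the Liechti–Strenner polynomial
`x^(2k-1) - x^k - x^(k-1) - 1` is irreducible in `ℤ[X]`. -/
theorem liechti_strenner_irreducible_int (k : ℕ) (hk : 2 ≤ k) :
    Irreducible (X ^ (2 * k - 1) - X ^ k - X ^ (k - 1) - 1 : ℤ[X]) := by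
  obtain ⟨m, rfl⟩ := Nat.exists_eq_add_of_le' (one_le_two.trans hk)
  convert irreducible_antiQuadrinomial (m := m) (by lia) using 1
  rw [antiQuadrinomial, show 2 * (m + 1) - 1 = m + 1 + m by lia, Nat.add_sub_cancel]
  simp only [map_neg, map_one]
  ring
end

section
/- For every natural number k ≥ 2 and every complex number λ with λ^(2k-1) - λ^k - λ^(k-1) - 1 = 0, the minimal polynomial of λ over ℚ has degree 2k-1; equivalently, the field extension ℚ(λ)/ℚ has degree 2k-1. -/
open Polynomial

namespace LiechtiStrenner

/-- The quadrinomial `s (X ^ (b + d + e) + ε (X ^ (b + d) + X ^ b) - 1)`, parametrised by the gaps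
`b`, `d`, `e` between its exponents. -/
noncomputable def quadrinomial (s ε : ℤ) (b d e : ℕ) : ℤ[X] :=
  C s * (X ^ (b + d + e) + C ε * (X ^ (b + d) + X ^ b) - 1)

theorem natDegree_quadrinomial {s : ℤ} (hs : s ≠ 0) (ε : ℤ) {b d e : ℕ} (hb : 0 < b) (hd : 0 < d)
    (he : 0 < e) : (quadrinomial s ε b d e).natDegree = b + d + e := by
  apply natDegree_eq_of_le_of_coeff_ne_zero
  · unfold quadrinomial
    compute_degree
  · simp [quadrinomial, coeff_X_pow, coeff_one, hs, hb.ne', hd.ne', he.ne',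
      show b + d + e ≠ b by omega]

theorem monic_quadrinomial (ε : ℤ) {b d e : ℕ} (hb : 0 < b) (hd : 0 < d) (he : 0 < e) :
    (quadrinomial 1 ε b d e).Monic := by
  rw [Monic, leadingCoeff, natDegree_quadrinomial one_ne_zero ε hb hd he]
  simp [quadrinomial, coeff_X_pow, coeff_one, hb.ne', he.ne', show b + d + e ≠ b by omega]

theorem coeff_zero_quadrinomial (s ε : ℤ) {b : ℕ} (d e : ℕ) (hb : 0 < b) :
    (quadrinomial s ε b d e).coeff 0 = -s := by
  simp [quadrinomial, coeff_X_pow, hb.ne, show 0 ≠ b + d + e by omega,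
    show 0 ≠ b + d by omega]

theorem mirror_quadrinomial {s : ℤ} (hs : s ≠ 0) (ε : ℤ) {b d e : ℕ} (hb : 0 < b) (hd : 0 < d)
    (he : 0 < e) : (quadrinomial s ε b d e).mirror = quadrinomial (-s) (-ε) e d b := by
  have htr : (quadrinomial s ε b d e).natTrailingDegree = 0 :=
    natTrailingDegree_eq_zero.2 (Or.inr (by simpa [coeff_zero_quadrinomial s ε d e hb] using hs))
  rw [mirror, htr, pow_zero, mul_one, reverse, natDegree_quadrinomial hs ε hb hd he, quadrinomial,
    reflect_C_mul, reflect_sub, reflect_add, reflect_C_mul, reflect_add, reflect_monomial,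
    reflect_monomial, reflect_monomial, reflect_one, revAt_le le_rfl, revAt_le (by omega),
    revAt_le (by omega), Nat.sub_self, show b + d + e - (b + d) = e by omega,
    show b + d + e - b = e + d by omega, quadrinomial, show e + d + b = b + d + e by omega]
  simp only [C_neg]
  ring

/-- Comparing the low-order coefficients of `p * p.mirror` for two quadrinomials. -/
theorem gaps_of_mul_mirror_eq {s ε : ℤ} (hs : s ^ 2 = 1) (hε : ε = 1 ∨ ε = -1) {j b d e : ℕ}
    (hj : 0 < j) (hb : 0 < b) (hd : 0 < d) (he : 0 < e) (hn : b + d + e = 2 * j + 1)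
    (h : quadrinomial 1 (-1) j 1 j * quadrinomial (-1) 1 j 1 j =
      quadrinomial s ε b d e * quadrinomial (-s) (-ε) e d b) :
    b = j ∧ d = 1 ∧ e = j := by
  have hε2 : ε ^ 2 = 1 := by rcases hε with rfl | rfl <;> rfl
  have hs' : (C s : ℤ[X]) ^ 2 = 1 := by rw [← C_pow, hs, C_1]
  have hε' : (C ε : ℤ[X]) ^ 2 = 1 := by rw [← C_pow, hε2, C_1]
  have hl : quadrinomial 1 (-1) j 1 j * quadrinomial (-1) 1 j 1 j =
      -(X ^ (2 * j + 1) - 1) ^ 2 + X ^ (2 * j + 1) * X + 2 * X ^ (2 * j + 1) + X ^ (2 * j) := by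
    simp only [quadrinomial, C_neg, C_1]
    ring
  have hr : quadrinomial s ε b d e * quadrinomial (-s) (-ε) e d b =
      -(X ^ (b + d + e) - 1) ^ 2 + C ε * (X ^ (b + d + e) - 1) *
        (X ^ e + X ^ (d + e) - X ^ (b + d) - X ^ b) + 2 * X ^ (b + d + e) +
        X ^ (b + d + e) * X ^ d + X ^ (b + e) := by
    simp only [quadrinomial, C_neg]
    linear_combination (-(X ^ (b + d + e) - 1 + C ε * (X ^ (b + d) + X ^ b)) *
      (X ^ (e + d + b) - 1 - C ε * (X ^ (e + d) + X ^ e)) : ℤ[X]) * hs' +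
      ((X ^ (b + d) + X ^ b) * (X ^ (e + d) + X ^ e)) * hε'
  rw [hl, hr, hn] at h
  have hdvd : (X : ℤ[X]) ^ (2 * j + 1) ∣
      X ^ (2 * j) - X ^ (b + e) + C ε * (X ^ e + X ^ (d + e) - X ^ (b + d) - X ^ b) :=
    ⟨X ^ d - X + C ε * (X ^ e + X ^ (d + e) - X ^ (b + d) - X ^ b), by linear_combination h⟩
  rw [X_pow_dvd_iff] at hdvd
  simp only [coeff_add, coeff_sub, coeff_C_mul, coeff_X_pow] at hdvd
  have h1 := hdvd (2 * j) (by omega)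
  have h2 := hdvd b (by omega)
  have h3 := hdvd e (by omega)
  have h4 := hdvd (b + e) (by omega)
  clear hdvd h hl hr hε' hs'
  rcases hε with rfl | rfl <;> grind (splits := 30)

/-- An integer polynomial whose squared coefficients sum to four, with extreme coefficients of
opposite sign and value `±2` at `1`, is a quadrinomial. -/
theorem exists_eq_quadrinomial {g : ℤ[X]} (h0 : g.natTrailingDegree = 0) (hdeg : 0 < g.natDegree)
    (hprod : g.leadingCoeff * g.trailingCoeff = -1) (hsum : g.sum (fun _ => (· ^ 2)) = 4)
    (hone : g.eval 1 ^ 2 = 4) :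
    ∃ s ε : ℤ, ∃ b d e : ℕ, s ^ 2 = 1 ∧ (ε = 1 ∨ ε = -1) ∧ 0 < b ∧ 0 < d ∧ 0 < e ∧
      b + d + e = g.natDegree ∧ g = quadrinomial s ε b d e := by
  have hg : g ≠ 0 := by rintro rfl; simp at hdeg
  obtain ⟨s, hs, hlead, htrail⟩ : ∃ s : ℤ, (s = 1 ∨ s = -1) ∧ g.coeff g.natDegree = s ∧
      g.coeff 0 = -s := by
    rw [trailingCoeff, h0, leadingCoeff] at hprod
    rcases Int.mul_eq_neg_one_iff_eq_one_or_neg_one.1 hprod with h | h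
    · exact ⟨1, by simp, h.1, h.2⟩
    · exact ⟨-1, by simp, h.1, by simpa using h.2⟩
  have hs0 : s ≠ 0 := by rcases hs with rfl | rfl <;> decide
  have hmem0 : 0 ∈ g.support := by simpa [htrail] using hs0
  have hmemn : g.natDegree ∈ g.support.erase 0 := by
    rw [Finset.mem_erase, mem_support_iff, hlead]
    exact ⟨hdeg.ne', hs0⟩
  set T := (g.support.erase 0).erase g.natDegree with hT
  have split {M : Type} [AddCommMonoid M] (F : ℕ → M) :
      ∑ i ∈ g.support, F i = F 0 + (F g.natDegree + ∑ i ∈ T, F i) := by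
    rw [← Finset.add_sum_erase _ F hmem0, ← Finset.add_sum_erase _ F hmemn]
  have hlt : ∀ i ∈ T, 0 < i ∧ i < g.natDegree ∧ 1 ≤ g.coeff i ^ 2 := by
    intro i hi
    simp only [hT, Finset.mem_erase] at hi
    have := le_natDegree_of_mem_supp i hi.2.2
    have := mem_support_iff.1 hi.2.2
    exact ⟨by omega, by omega, by have := sq_pos_of_ne_zero this; omega⟩
  have hsq : ∑ i ∈ T, g.coeff i ^ 2 = 2 := by
    rw [sum_def, split, hlead, htrail] at hsum
    rcases hs with rfl | rfl <;> linarith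
  have hcard : T.card ≤ 2 := by
    have := Finset.card_nsmul_le_sum T (fun i => g.coeff i ^ 2) 1 fun i hi => (hlt i hi).2.2
    rw [hsq] at this
    simpa using this
  have hcard2 : T.card = 2 := by
    interval_cases hc : T.card
    · simp [Finset.card_eq_zero.1 hc] at hsq
    · obtain ⟨i, hi⟩ := Finset.card_eq_one.1 hc
      rw [hi, Finset.sum_singleton] at hsq
      have : g.coeff i < 2 := by nlinarith
      have : -2 < g.coeff i := by nlinarith
      interval_cases g.coeff i <;> omega
    · rfl
  obtain ⟨b, a, hba, hTab⟩ : ∃ b a, b < a ∧ T = {b, a} := by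
    obtain ⟨x, y, hxy, h⟩ := Finset.card_eq_two.1 hcard2
    rcases lt_or_gt_of_ne hxy with h' | h'
    · exact ⟨x, y, h', h⟩
    · exact ⟨y, x, h', by rw [h, Finset.pair_comm]⟩
  have hbT := hlt b (by simp [hTab])
  have haT := hlt a (by simp [hTab])
  rw [hTab, Finset.sum_pair hba.ne] at hsq
  have hcb : g.coeff b = 1 ∨ g.coeff b = -1 := sq_eq_one_iff.1 (by linarith)
  have hca : g.coeff a = 1 ∨ g.coeff a = -1 := sq_eq_one_iff.1 (by linarith)
  have heval : g.eval 1 = g.coeff b + g.coeff a := by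
    rw [eval_eq_sum, sum_def, split, hlead, htrail, hTab, Finset.sum_pair hba.ne]
    simp
  have hab : g.coeff a = g.coeff b := by
    rw [heval] at hone
    rcases hca with h | h <;> rcases hcb with h' | h' <;> rw [h, h'] at hone ⊢ <;> norm_num at hone
  refine ⟨s, s * g.coeff b, b, a - b, g.natDegree - a, ?_, ?_, hbT.1, by omega, by omega, by omega,
    ?_⟩
  · rcases hs with rfl | rfl <;> rfl
  · rcases hs with rfl | rfl <;> rcases hcb with h | h <;> simp [h]
  · have hs2 : (C s : ℤ[X]) * C s = 1 := by rcases hs with rfl | rfl <;> simp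
    have hrep : g = C (-s) * X ^ 0 + (C s * X ^ g.natDegree +
        (C (g.coeff b) * X ^ b + C (g.coeff b) * X ^ a)) := by
      conv_lhs => rw [g.as_sum_support_C_mul_X_pow, split, hlead, htrail, hTab,
        Finset.sum_pair hba.ne, hab]
    rw [quadrinomial, show b + (a - b) + (g.natDegree - a) = g.natDegree by omega,
      show b + (a - b) = a by omega]
    conv_lhs => rw [hrep]
    simp only [C_neg, C_mul]
    linear_combination (-C (g.coeff b) * (X ^ a + X ^ b) : ℤ[X]) * hs2

theorem isRelPrime_mirror {j : ℕ} (hj : 0 < j) :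
    IsRelPrime (quadrinomial 1 (-1) j 1 j) (quadrinomial 1 (-1) j 1 j).mirror := by
  rw [mirror_quadrinomial one_ne_zero _ hj one_pos hj]
  rintro q ⟨r, hr⟩ hq
  have hlead : IsUnit q.leadingCoeff := by
    have hmonic := (monic_quadrinomial (-1) hj one_pos hj).leadingCoeff
    rw [hr, leadingCoeff_mul] at hmonic
    exact IsUnit.of_mul_eq_one _ hmonic
  suffices hdeg : q.natDegree = 0 by
    rw [leadingCoeff, hdeg] at hlead
    rw [eq_C_of_natDegree_eq_zero hdeg]
    exact isUnit_C.2 hlead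
  by_contra hdeg
  obtain ⟨z, hz⟩ := IsAlgClosed.exists_aeval_eq_zero ℂ q fun h =>
    hdeg (natDegree_eq_of_degree_eq_some h)
  have h1 : aeval z (quadrinomial 1 (-1) j 1 j) = 0 := by rw [hr, map_mul, hz, zero_mul]
  have h2 := aeval_eq_zero_of_dvd_aeval_eq_zero hq hz
  simp only [quadrinomial, map_sub, map_add, map_pow, aeval_X, map_one, map_neg, neg_neg,
    one_mul, neg_mul] at h1 h2
  have h3 : z ^ j * (z + 1) = 0 := by linear_combination (-1 / 2 : ℂ) * (h1 + h2)
  rcases mul_eq_zero.1 h3 with h | h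
  · rw [pow_add, pow_add, h] at h1
    simp at h1
  · obtain rfl : z = -1 := by linear_combination h
    have : ((-1 : ℂ) ^ j) ^ 2 = 1 := by rw [← pow_mul, mul_comm, pow_mul]; simp
    have h4 : (-2 : ℂ) = 0 := by linear_combination h1 + this
    norm_num at h4

theorem irreducible_quadrinomial {j : ℕ} (hj : 0 < j) :
    Irreducible (quadrinomial 1 (-1) j 1 j) := by
  have hdeg := natDegree_quadrinomial one_ne_zero (-1) hj one_pos hj
  have hmir := mirror_quadrinomial one_ne_zero (-1) hj one_pos hj
  rw [neg_neg] at hmir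
  refine irreducible_of_mirror (fun h => ?_) (fun g hg => ?_) (isRelPrime_mirror hj)
  · have := natDegree_eq_zero_of_isUnit h
    omega
  set f := quadrinomial 1 (-1) j 1 j with hf
  have htr : f.natTrailingDegree = 0 :=
    natTrailingDegree_eq_zero.2 (Or.inr (by simp [hf, coeff_zero_quadrinomial 1 (-1) 1 j hj]))
  have hgdeg : g.natDegree = j + 1 + j := by
    have := natDegree_mul_mirror f
    rw [hg, natDegree_mul_mirror] at this
    omega
  have hgtr : g.natTrailingDegree = 0 := by
    have := natTrailingDegree_mul_mirror f
    rw [hg, natTrailingDegree_mul_mirror] at this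
    omega
  have hf_lead : f.leadingCoeff = 1 := (monic_quadrinomial (-1) hj one_pos hj).leadingCoeff
  have hprod : g.leadingCoeff * g.trailingCoeff = -1 := by
    have := congrArg leadingCoeff hg
    rw [leadingCoeff_mul, leadingCoeff_mul, mirror_leadingCoeff, mirror_leadingCoeff, hf_lead,
      trailingCoeff, htr, coeff_zero_quadrinomial 1 (-1) 1 j hj] at this
    linarith
  have hone : g.eval 1 ^ 2 = 4 := by
    have := congrArg (eval 1) hg
    rw [eval_mul, eval_mul, mirror_eval_one, mirror_eval_one, ← sq, ← sq] at this
    rw [← this]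
    simp [hf, quadrinomial]
  have hsum : g.sum (fun _ => (· ^ 2)) = 4 := by
    rw [← coeff_mul_mirror, ← hg, hgdeg, hgtr, hmir, hf]
    have hl : quadrinomial 1 (-1) j 1 j * quadrinomial (-1) 1 j 1 j =
        - X ^ (4 * j + 2) + X ^ (2 * j + 2) + C 4 * X ^ (2 * j + 1) + X ^ (2 * j) - 1 := by
      simp only [quadrinomial, C_neg, C_1, show (C 4 : ℤ[X]) = 4 from rfl]
      ring
    rw [hl]
    simp only [coeff_add, coeff_sub, coeff_neg, coeff_C_mul, coeff_X_pow, coeff_one]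
    grind
  obtain ⟨s, ε, b, d, e, hs, hε, hb, hd, he, hn, hgq⟩ :=
    exists_eq_quadrinomial hgtr (by omega) hprod hsum hone
  have hs0 : s ≠ 0 := by rintro rfl; norm_num at hs
  rw [hmir, hgq, mirror_quadrinomial hs0 ε hb hd he] at hg
  obtain ⟨rfl, rfl, rfl⟩ := gaps_of_mul_mirror_eq hs hε hj hb hd he (by omega) hg
  rw [hmir, hgq, hf]
  rcases sq_eq_one_iff.1 hs with rfl | rfl <;> rcases hε with rfl | rfl <;>
    simp [quadrinomial]

end LiechtiStrenner

open LiechtiStrenner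

/-- For every `k ≥ 2` and every complex root `λ` of the Liechti–Strenner
polynomial, the minimal polynomial of `λ` over `ℚ` has degree `2k - 1`. -/
theorem minpoly_degree_of_root (k : ℕ) (hk : 2 ≤ k) (lam : ℂ)
    (h : lam ^ (2 * k - 1) - lam ^ k - lam ^ (k - 1) - 1 = 0) :
    (minpoly ℚ lam).natDegree = 2 * k - 1 := by
  obtain ⟨j, rfl⟩ : ∃ j, k = j + 1 := ⟨k - 1, by omega⟩
  have hj : 0 < j := by omega
  rw [show 2 * (j + 1) - 1 = j + 1 + j by omega] at h ⊢
  rw [Nat.add_sub_cancel] at h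
  have hdeg := natDegree_quadrinomial one_ne_zero (-1) hj one_pos hj
  have hmonic := monic_quadrinomial (-1) hj one_pos hj
  have hirr := (hmonic.irreducible_iff_irreducible_map_fraction_map (K := ℚ)).1
    (irreducible_quadrinomial hj)
  have hroot : aeval lam ((quadrinomial 1 (-1) j 1 j).map (algebraMap ℤ ℚ)) = 0 := by
    rw [aeval_map_algebraMap]
    simp only [quadrinomial, map_mul, map_sub, map_add, map_pow, aeval_X, map_one, map_neg]
    linear_combination h
  rw [← minpoly.eq_of_irreducible_of_monic hirr hroot (hmonic.map _), hmonic.natDegree_map, hdeg]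
end
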